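/- arXiv:math/0406513 — 2 statements merged into one kernel-verified Lean document; each statement's English description precedes it below -/
import Mathlib

section
/- Let S be a finite set with |S| = N ≥ 1, let p be a probability mass function on S, and let B ⊆ S be nonempty with Σ_{x∈B} p(x) ≥ ε for some ε ∈ (0,1] and |B| ≤ δ·N for some δ ∈ (0,1]. Then H(p) ≤ log N + log 2 + ε·log δ. In particular, if |B| ≤ e^{−cn}·N and Σ_{x∈B} p(x) ≥ ε, then H(p) ≤ log N + log 2 − ε·c·n. -/
open Real

/-- The pointwise form of Gibbs' inequality. -/
lemma neg_mul_log_le_neg_mul_log_add_sub {a b : ℝ} (ha : 0 ≤ a) (hb : 0 < b) :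
    -(a * Real.log a) ≤ -(a * Real.log b) + (b - a) := by
  rcases ha.eq_or_lt with rfl | ha
  · simpa using hb.le
  · have h := mul_le_mul_of_nonneg_left (Real.log_le_sub_one_of_pos (div_pos hb ha)) ha.le
    rw [Real.log_div hb.ne' ha.ne', mul_sub, mul_sub, mul_div_cancel₀ _ ha.ne'] at h
    linarith

/-- Gibbs' inequality, for a subprobability weight `q` of full support. -/
lemma neg_sum_mul_log_le_of_sum_le_one {S : Type*} [Fintype S] {p q : S → ℝ}
    (hp0 : ∀ x, 0 ≤ p x) (hp1 : ∑ x, p x = 1) (hq0 : ∀ x, 0 < q x) (hq1 : ∑ x, q x ≤ 1) :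
    -∑ x, p x * Real.log (p x) ≤ -∑ x, p x * Real.log (q x) := by
  have h := Finset.sum_le_sum fun x (_ : x ∈ Finset.univ) =>
    neg_mul_log_le_neg_mul_log_add_sub (hp0 x) (hq0 x)
  rw [Finset.sum_add_distrib, Finset.sum_sub_distrib, Finset.sum_neg_distrib,
    Finset.sum_neg_distrib] at h
  linarith

/-- The entropy is small if a small set carries a definite proportion of the mass. -/
lemma neg_sum_mul_log_le_of_card_le {S : Type*} [Fintype S] [Nonempty S] {p : S → ℝ}
    (hp0 : ∀ x, 0 ≤ p x) (hp1 : ∑ x, p x = 1) {B : Finset S} {ε δ : ℝ}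
    (hδ0 : 0 < δ) (hδ1 : δ ≤ 1) (hBp : ε ≤ ∑ x ∈ B, p x)
    (hBcard : (B.card : ℝ) ≤ δ * Fintype.card S) :
    -∑ x, p x * Real.log (p x) ≤
      Real.log (Fintype.card S) + Real.log 2 + ε * Real.log δ := by
  classical
  have hN : (0 : ℝ) < Fintype.card S := by exact_mod_cast Fintype.card_pos
  set N : ℝ := (Fintype.card S : ℝ) with hNdef
  let q : S → ℝ := fun x => if x ∈ B then (2 * N * δ)⁻¹ else (2 * N)⁻¹
  have hq0 : ∀ x, 0 < q x := fun x => by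
    dsimp only [q]
    split_ifs <;> positivity
  have hq1 : ∑ x, q x ≤ 1 := by
    have hle : ∀ x, q x ≤ (if x ∈ B then (2 * N * δ)⁻¹ else 0) + (2 * N)⁻¹ := fun x => by
      have : 0 < (2 * N)⁻¹ := by positivity
      dsimp only [q]
      split_ifs <;> linarith
    calc ∑ x, q x ≤ ∑ x, ((if x ∈ B then (2 * N * δ)⁻¹ else 0) + (2 * N)⁻¹) :=
          Finset.sum_le_sum fun x _ => hle x
      _ = B.card * (2 * N * δ)⁻¹ + N * (2 * N)⁻¹ := by
          simp [Finset.sum_add_distrib, hNdef]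
      _ ≤ δ * N * (2 * N * δ)⁻¹ + N * (2 * N)⁻¹ := by gcongr
      _ = 1 := by
          field_simp
          norm_num
  have hlog : ∀ x, p x * Real.log (q x) =
      -(p x * Real.log (2 * N)) - (if x ∈ B then p x else 0) * Real.log δ := fun x => by
    dsimp only [q]
    split_ifs
    · rw [Real.log_inv, Real.log_mul (by positivity) hδ0.ne']
      ring
    · rw [Real.log_inv]
      ring
  have hsum : ∑ x, p x * Real.log (q x) =
      -Real.log (2 * N) - (∑ x ∈ B, p x) * Real.log δ := by
    simp_rw [hlog]
    rw [Finset.sum_sub_distrib, Finset.sum_neg_distrib, ← Finset.sum_mul, ← Finset.sum_mul, hp1]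
    simp
  have h := neg_sum_mul_log_le_of_sum_le_one hp0 hp1 hq0 hq1
  rw [hsum, Real.log_mul two_ne_zero hN.ne'] at h
  have := mul_le_mul_of_nonpos_right hBp (Real.log_nonpos hδ0.le hδ1)
  linarith

/-- **Entropy-gap estimate.** Let `p` be a probability mass function on a finite set `S`
of cardinality `N ≥ 1`, and `B ⊆ S` nonempty with `p(B) ≥ ε` (`ε ∈ (0,1]`) and
`|B| ≤ δ N` (`δ ∈ (0,1]`). Then `H(p) ≤ log N + log 2 + ε log δ`. In particular, if
`|B| ≤ e^{-cn} N` and `p(B) ≥ ε`, then `H(p) ≤ log N + log 2 - ε c n`. -/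
theorem entropy_gap_estimate {S : Type*} [Fintype S]
    (N : ℕ) (hN : Fintype.card S = N) (hN1 : 1 ≤ N)
    (p : S → ℝ) (hp0 : ∀ x, 0 ≤ p x) (hp1 : ∑ x, p x = 1)
    (B : Finset S) (hB : B.Nonempty)
    (ε : ℝ) (hε : ε ∈ Set.Ioc (0 : ℝ) 1) (δ : ℝ) (hδ : δ ∈ Set.Ioc (0 : ℝ) 1)
    (hBp : ε ≤ ∑ x ∈ B, p x) (hBcard : (B.card : ℝ) ≤ δ * N) :
    (-∑ x, p x * Real.log (p x) ≤ Real.log N + Real.log 2 + ε * Real.log δ) ∧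
      (∀ c n : ℝ, (B.card : ℝ) ≤ Real.exp (-(c * n)) * N →
        -∑ x, p x * Real.log (p x) ≤ Real.log N + Real.log 2 - ε * c * n) := by
  subst hN
  have : Nonempty S := Fintype.card_pos_iff.mp hN1
  refine ⟨neg_sum_mul_log_le_of_card_le hp0 hp1 hδ.1 hδ.2 hBp hBcard, fun c n hcn => ?_⟩
  rcases le_total 0 (c * n) with h | h
  · have key := neg_sum_mul_log_le_of_card_le hp0 hp1 (Real.exp_pos _)
      (Real.exp_le_one_iff.mpr (neg_nonpos.mpr h)) hBp hcn
    rw [Real.log_exp] at key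
    linarith
  · have key := neg_sum_mul_log_le_of_card_le hp0 hp1 one_pos le_rfl hBp
      (by simpa using B.card_le_univ)
    rw [Real.log_one] at key
    have := mul_nonpos_of_nonneg_of_nonpos hε.1.le h
    linarith
end

section
/- Let T be a tree (a connected, acyclic simple graph). If T contains two disjoint rays (two rays whose vertex images are disjoint), then T contains a bi-infinite path, i.e., an injective map p : ℤ → V(T) with p(n) adjacent to p(n+1) for all n ∈ ℤ. -/
/-- A ray in a graph: an injective map `r : ℕ → V` with consecutive vertices adjacent. -/
def SimpleGraph.IsRay {V : Type*} (G : SimpleGraph V) (r : ℕ → V) : Prop :=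
  Function.Injective r ∧ ∀ n : ℕ, G.Adj (r n) (r (n + 1))

/-- A bi-infinite path: an injective map `p : ℤ → V` with consecutive vertices adjacent. -/
def SimpleGraph.IsBiInfinitePath {V : Type*} (G : SimpleGraph V) (p : ℤ → V) : Prop :=
  Function.Injective p ∧ ∀ n : ℤ, G.Adj (p n) (p (n + 1))

namespace SimpleGraph

variable {V : Type*} {G : SimpleGraph V}

theorem IsRay.shift {r : ℕ → V} (hr : G.IsRay r) (i : ℕ) : G.IsRay fun n => r (i + n) :=
  ⟨fun _ _ h => Nat.add_left_cancel (hr.1 h), fun n => hr.2 (i + n)⟩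

theorem IsRay.cons {r : ℕ → V} (hr : G.IsRay r) {v : V} (hv : v ∉ Set.range r)
    (hadj : G.Adj v (r 0)) : G.IsRay fun n => n.casesOn v r := by
  refine ⟨?_, ?_⟩
  · rintro (_ | m) (_ | n) h
    · rfl
    · exact absurd ⟨n, h.symm⟩ hv
    · exact absurd ⟨m, h⟩ hv
    · exact congrArg _ (hr.1 h)
  · rintro (_ | n)
    · exact hadj
    · exact hr.2 n

/-- Two disjoint rays with adjacent starting vertices glue to a bi-infinite path. -/
theorem IsRay.exists_isBiInfinitePath_of_adj {r s : ℕ → V} (hr : G.IsRay r) (hs : G.IsRay s)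
    (hdisj : ∀ m n, r m ≠ s n) (hadj : G.Adj (r 0) (s 0)) :
    ∃ p : ℤ → V, G.IsBiInfinitePath p := by
  refine ⟨fun n => Int.casesOn n s r, ?_, ?_⟩
  · rintro (m | m) (n | n) h
    · exact congrArg _ (hs.1 h)
    · exact absurd h.symm (hdisj n m)
    · exact absurd h (hdisj m n)
    · exact congrArg _ (hr.1 h)
  · rintro (n | _ | n)
    · exact hs.2 n
    · exact hadj
    · exact (hr.2 n).symm

/-- Two disjoint rays joined by a walk yield a bi-infinite path. -/
theorem Walk.exists_isBiInfinitePath {u v : V} (w : G.Walk u v) {r s : ℕ → V}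
    (hr : G.IsRay r) (hs : G.IsRay s) (hdisj : ∀ m n, r m ≠ s n)
    (hu : u ∈ Set.range r) (hv : v ∈ Set.range s) :
    ∃ p : ℤ → V, G.IsBiInfinitePath p := by
  induction w generalizing r with
  | nil =>
    obtain ⟨m, rfl⟩ := hu
    obtain ⟨n, hn⟩ := hv
    exact absurd hn.symm (hdisj m n)
  | @cons u x v hadj w ih =>
    by_cases hxr : x ∈ Set.range r
    · exact ih hr hdisj hxr hv
    obtain ⟨i, rfl⟩ := hu
    by_cases hxs : x ∈ Set.range s
    · obtain ⟨j, rfl⟩ := hxs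
      exact (hr.shift i).exists_isBiInfinitePath_of_adj (hs.shift j)
        (fun m n => hdisj (i + m) (j + n)) hadj
    · refine ih ((hr.shift i).cons ?_ hadj.symm) ?_ ⟨0, rfl⟩ hv
      · rintro ⟨n, hn⟩
        exact hxr ⟨i + n, hn⟩
      · rintro (_ | m) n h
        · exact hxs ⟨n, h.symm⟩
        · exact hdisj (i + m) n h

end SimpleGraph

/-- **A tree with two disjoint rays contains a bi-infinite path** (the trunk of a
two-ended tree). -/
theorem tree_two_disjoint_rays_biInfinitePath {V : Type*} (T : SimpleGraph V)
    (hconn : T.Connected) (hacyc : T.IsAcyclic)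
    (r s : ℕ → V) (hr : T.IsRay r) (hs : T.IsRay s)
    (hdisj : Disjoint (Set.range r) (Set.range s)) :
    ∃ p : ℤ → V, T.IsBiInfinitePath p := by
  obtain ⟨w⟩ := hconn.preconnected (r 0) (s 0)
  exact w.exists_isBiInfinitePath hr hs
    (fun m n => hdisj.ne_of_mem (Set.mem_range_self m) (Set.mem_range_self n))
    (Set.mem_range_self 0) (Set.mem_range_self 0)
end
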